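/- Let E ⊆ k^s be a finite set of points and let e, e′ : E → k be two error vectors with e_P ≠ 0 and e′_P ≠ 0 for all P ∈ E (i.e., with the same support E). Then the S-submodules of Hom_k(S,k) generated by the syndrome functionals Λ_e and Λ_{e′} are equal: ⟨Λ_e⟩ = ⟨Λ_{e′}⟩. -/

import Mathlib

open MvPolynomial

variable {k : Type*} [Field k] {s : ℕ}

/-- The contraction action of `S = k[X_1,…,X_s]` on its linear dual `Hom_k(S,k)`:
`(f • Λ)(g) = Λ(f g)`. -/
noncomputable instance dualSMul :
    SMul (MvPolynomial (Fin s) k) (Module.Dual k (MvPolynomial (Fin s) k)) :=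
  ⟨fun f Λ => Λ.comp (LinearMap.mulLeft k f)⟩

theorem dual_smul_apply (f : MvPolynomial (Fin s) k)
    (Λ : Module.Dual k (MvPolynomial (Fin s) k)) (p : MvPolynomial (Fin s) k) :
    (f • Λ) p = Λ (f * p) := rfl

noncomputable instance dualMulAction :
    MulAction (MvPolynomial (Fin s) k) (Module.Dual k (MvPolynomial (Fin s) k)) where
  one_smul Λ := by refine LinearMap.ext fun p => ?_; simp [dual_smul_apply]
  mul_smul f g Λ := by refine LinearMap.ext fun p => ?_; simp only [dual_smul_apply]; congr 1; ring

noncomputable instance dualDistribMulAction :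
    DistribMulAction (MvPolynomial (Fin s) k) (Module.Dual k (MvPolynomial (Fin s) k)) where
  smul_zero f := by refine LinearMap.ext fun p => ?_; simp [dual_smul_apply]
  smul_add f Λ₁ Λ₂ := by refine LinearMap.ext fun p => ?_; simp [dual_smul_apply]

noncomputable instance dualModule :
    Module (MvPolynomial (Fin s) k) (Module.Dual k (MvPolynomial (Fin s) k)) where
  add_smul f g Λ := by refine LinearMap.ext fun p => ?_; simp [dual_smul_apply, add_mul]
  zero_smul Λ := by refine LinearMap.ext fun p => ?_; simp [dual_smul_apply]

/-- The inverse system (annihilator) `I^⊥ ⊆ Hom_k(S,k)` of an ideal `I ⊆ S`,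
as an `S`-submodule of the dual. -/
noncomputable def idealPerp (I : Ideal (MvPolynomial (Fin s) k)) :
    Submodule (MvPolynomial (Fin s) k) (Module.Dual k (MvPolynomial (Fin s) k)) where
  carrier := {Λ | ∀ p ∈ I, Λ p = 0}
  zero_mem' := by intro p _; simp
  add_mem' := by intro Λ₁ Λ₂ h₁ h₂ p hp; simp [h₁ p hp, h₂ p hp]
  smul_mem' := by
    intro f Λ hΛ p hp
    simpa [dual_smul_apply] using hΛ (f * p) (I.mul_mem_left f hp)

/-- The annihilator `H^⊥ ⊆ S` of an `S`-submodule `H ⊆ Hom_k(S,k)`, as an ideal of `S`. -/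
noncomputable def submodPerp
    (H : Submodule (MvPolynomial (Fin s) k) (Module.Dual k (MvPolynomial (Fin s) k))) :
    Ideal (MvPolynomial (Fin s) k) where
  carrier := {p | ∀ Λ ∈ H, Λ p = 0}
  zero_mem' := by intro Λ _; simp
  add_mem' := by intro a b ha hb Λ hΛ; simp [ha Λ hΛ, hb Λ hΛ]
  smul_mem' := by
    intro c p hp Λ hΛ
    simpa [smul_eq_mul, dual_smul_apply] using hp (c • Λ) (H.smul_mem c hΛ)

/-- The error-locator ideal `I(E) = {f ∈ S : f(P) = 0 for all P ∈ E}` of a finite set of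
points `E ⊆ k^s`. -/
noncomputable def locatorIdeal (E : Finset (Fin s → k)) : Ideal (MvPolynomial (Fin s) k) where
  carrier := {f | ∀ P ∈ E, MvPolynomial.eval P f = 0}
  zero_mem' := by intro P _; simp
  add_mem' := by intro f g hf hg P hP; simp [hf P hP, hg P hP]
  smul_mem' := by intro c f hf P hP; simp [smul_eq_mul, hf P hP]

/-- The syndrome functional `Λ_e ∈ Hom_k(S,k)` of an error vector `e` supported on a finite
set `E ⊆ k^s` of points: `Λ_e(p) = Σ_{P∈E} e_P p(P)`. -/
noncomputable def syndromeFunctional (E : Finset (Fin s → k)) (e : (Fin s → k) → k) :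
    Module.Dual k (MvPolynomial (Fin s) k) :=
  ∑ P ∈ E, e P • (MvPolynomial.aeval P).toLinearMap

/-- Polynomial functions interpolate arbitrary values on finite sets of points. -/
theorem exists_eval_eq_on_finset {σ K : Type*} [Field K] (E : Finset (σ → K)) (v : (σ → K) → K) :
    ∃ f : MvPolynomial σ K, ∀ P ∈ E, eval P f = v P := by
  classical
  have separate (P Q : σ → K) :
      ∃ f : MvPolynomial σ K, eval P f = 1 ∧ (Q ≠ P → eval Q f = 0) := by
    by_cases h : Q = P
    · exact ⟨1, by simp, fun h' => absurd h h'⟩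
    · obtain ⟨i, hi⟩ := Function.ne_iff.mp h
      refine ⟨C (P i - Q i)⁻¹ * (X i - C (Q i)), ?_, fun _ => by simp⟩
      simp [inv_mul_cancel₀ (sub_ne_zero.mpr hi.symm)]
  choose g hg_self hg_ne using separate
  refine ⟨∑ P ∈ E, C (v P) * ∏ Q ∈ E, g P Q, fun P hP => ?_⟩
  simp only [map_sum, map_mul, map_prod, eval_C]
  rw [Finset.sum_eq_single_of_mem P hP]
  · simp [hg_self]
  · intro Q _ hQP
    rw [Finset.prod_eq_zero hP (hg_ne Q P hQP.symm), mul_zero]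

theorem syndromeFunctional_apply {K : Type*} [Field K] {n : ℕ} (E : Finset (Fin n → K))
    (e : (Fin n → K) → K) (p : MvPolynomial (Fin n) K) :
    syndromeFunctional E e p = ∑ P ∈ E, e P * eval P p := by
  simp [syndromeFunctional, LinearMap.sum_apply, aeval_eq_eval]

/-- If `e` vanishes nowhere on `E`, then `Λ_e` generates every syndrome functional
supported on `E`. -/
theorem syndromeFunctional_mem_span {K : Type*} [Field K] {n : ℕ} (E : Finset (Fin n → K))
    (e e' : (Fin n → K) → K) (he : ∀ P ∈ E, e P ≠ 0) :
    syndromeFunctional E e' ∈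
      Submodule.span (MvPolynomial (Fin n) K) {syndromeFunctional E e} := by
  obtain ⟨f, hf⟩ := exists_eval_eq_on_finset E fun P => e' P / e P
  refine Submodule.mem_span_singleton.mpr ⟨f, LinearMap.ext fun p => ?_⟩
  rw [dual_smul_apply, syndromeFunctional_apply, syndromeFunctional_apply]
  refine Finset.sum_congr rfl fun P hP => ?_
  rw [map_mul, hf P hP, ← mul_assoc, mul_div_cancel₀ _ (he P hP)]

/-- If `e, e′` are two error vectors with the same support `E`
(`e_P ≠ 0` and `e′_P ≠ 0` for all `P ∈ E`), then the `S`-submodules of `Hom_k(S,k)`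
generated by the syndrome functionals `Λ_e` and `Λ_{e′}` coincide. -/
theorem span_syndrome_eq_of_same_support (k : Type*) [Field k] (s : ℕ) (hs : 1 ≤ s)
    (E : Finset (Fin s → k)) (e e' : (Fin s → k) → k)
    (he : ∀ P ∈ E, e P ≠ 0) (he' : ∀ P ∈ E, e' P ≠ 0) :
    Submodule.span (MvPolynomial (Fin s) k) {syndromeFunctional E e} =
      Submodule.span (MvPolynomial (Fin s) k) {syndromeFunctional E e'} := by
  apply le_antisymm <;> rw [Submodule.span_singleton_le_iff_mem]
  · exact syndromeFunctional_mem_span E e' e he'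
  · exact syndromeFunctional_mem_span E e e' he
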